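/- arXiv:2302.00713 — 2 statements merged into one kernel-verified Lean document; each statement's English description precedes it below -/
import Mathlib

section
/- Fix q ∈ (0,1), d ≥ 1 and k ∈ ℕ, and let K be a compact subset of the pseudometric space (𝒢(ℝ^d), d_{G,q}^(k)) of ℝ^d-labeled finite weighted graphs. Then the set NN_k^q(ℝ^d)|_K of restrictions to K of k-layer MP-GNNs with damping q is dense (with respect to the supremum norm) in the space C(K,ℝ) of continuous real-valued functions on K; i.e. its closure equals C(K,ℝ). -/
open Finset

noncomputable section

/-- An ℝ^d-labeled finite edge-weighted graph: nonempty vertex set `Fin n`, symmetric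
nonnegative weights with zero diagonal (an edge is present exactly when its weight is
positive), and vertex labels in `ℝ^d`. -/
structure LabeledGraph (d : ℕ) where
  n : ℕ
  n_pos : 0 < n
  w : Fin n → Fin n → ℝ
  w_nonneg : ∀ u v, 0 ≤ w u v
  w_symm : ∀ u v, w u v = w v u
  w_loopless : ∀ v, w v v = 0
  label : Fin n → EuclideanSpace ℝ (Fin d)

namespace LabeledGraph

variable {d : ℕ}

/-- The (weighted) degree `deg(v) = Σ_{v'} w_{vv'}`. -/
def deg (G : LabeledGraph d) (v : Fin G.n) : ℝ := ∑ v', G.w v v'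

/-- The modified degree `d̄eg(v)`. -/
def dbar (G : LabeledGraph d) (v : Fin G.n) : ℝ := if 0 < G.deg v then G.deg v else 1

/-- The stationary measure `μ_G(v) = d̄eg(v)/Σ_{v'} d̄eg(v')`. -/
def statMeas (G : LabeledGraph d) (v : Fin G.n) : ℝ := G.dbar v / ∑ v', G.dbar v'

/-- The `q`-damped Markov kernel `m^{G,q}` of the graph, by its value at `v'`. -/
def kernel (G : LabeledGraph d) (q : ℝ) (v v' : Fin G.n) : ℝ :=
  if 0 < G.deg v then (if v' = v then q else 0) + (1 - q) * G.w v v' / G.deg v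
  else if v' = v then 1 else 0

end LabeledGraph

/-- `π` is a coupling of the two probability vectors `p : A → ℝ` and `p' : B → ℝ`. -/
def IsCouplingFn {A B : Type*} [Fintype A] [Fintype B] (π : A × B → ℝ)
    (p : A → ℝ) (p' : B → ℝ) : Prop :=
  (∀ r, 0 ≤ π r) ∧ (∀ a, ∑ b, π (a, b) = p a) ∧ (∀ b, ∑ a, π (a, b) = p' b)

/-- A 1-step coupling between the Markov kernels `mA` and `mB`. -/
def IsOneStepCoupling {A B : Type*} [Fintype A] [Fintype B]
    (mA : A → A → ℝ) (mB : B → B → ℝ) (ν : A × B → A × B → ℝ) : Prop :=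
  ∀ p, IsCouplingFn (ν p) (mA p.1) (mB p.2)

/-- `k`-step couplings between the Markov kernels `mA` and `mB` (for `k = 0`, the identity
kernel, so that `ν^{(0)} ⊙ γ = γ`). -/
inductive IsKStepCoupling {A B : Type*} [Fintype A] [Fintype B] [DecidableEq A] [DecidableEq B]
    (mA : A → A → ℝ) (mB : B → B → ℝ) : ℕ → (A × B → A × B → ℝ) → Prop
  | zero (ν : A × B → A × B → ℝ) (h : ∀ p r, ν p r = if r = p then 1 else 0) :
      IsKStepCoupling mA mB 0 ν
  | one (ν : A × B → A × B → ℝ) (h : IsOneStepCoupling mA mB ν) : IsKStepCoupling mA mB 1 ν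
  | succ (k : ℕ) (ν' ν₁ ν : A × B → A × B → ℝ) (h' : IsKStepCoupling mA mB k ν')
      (h₁ : IsOneStepCoupling mA mB ν₁) (h : ∀ p r, ν p r = ∑ s, ν₁ p s * ν' s r) :
      IsKStepCoupling mA mB (k + 1) ν

/-- `ν ⊙ γ := ∫ ν_{x,y} γ(dx×dy)`. -/
def odotFn {A B : Type*} [Fintype A] [Fintype B]
    (ν : A × B → A × B → ℝ) (γ : A × B → ℝ) : A × B → ℝ :=
  fun r => ∑ p, γ p * ν p r

/-- The Weisfeiler–Lehman distance of depth `k` between two labeled measure Markov chains on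
finite state spaces, via its `k`-step coupling characterization: the infimum over
`γ^{(k)} = ν^{(k)} ⊙ γ ∈ C^{(k)}(μ_A,μ_B)` of `∫ d_Z(ℓ_A(x),ℓ_B(y)) γ^{(k)}(dx×dy)`. -/
def dWL {A B Z : Type*} [Fintype A] [Fintype B] [DecidableEq A] [DecidableEq B]
    [PseudoMetricSpace Z] (k : ℕ)
    (mA : A → A → ℝ) (μA : A → ℝ) (lA : A → Z)
    (mB : B → B → ℝ) (μB : B → ℝ) (lB : B → Z) : ℝ :=
  sInf {r : ℝ | ∃ γ ν, IsCouplingFn γ μA μB ∧ IsKStepCoupling mA mB k ν ∧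
    r = ∑ p : A × B, odotFn ν γ p * dist (lA p.1) (lB p.2)}

/-- The `q`-damped WL distance of depth `k` between labeled graphs. -/
def dGq {d : ℕ} (q : ℝ) (k : ℕ) (G₁ G₂ : LabeledGraph d) : ℝ :=
  dWL k (G₁.kernel q) G₁.statMeas G₁.label (G₂.kernel q) G₂.statMeas G₂.label

/-- Dimension sequence with prescribed initial value `d` and tail `t`. -/
def dimSeq (d : ℕ) (t : ℕ → ℕ) : ℕ → ℕ
  | 0 => d
  | i + 1 => t i

/-- The node features `ℓ_G^i` computed by the message-passing layers of an MP-GNN with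
damping `q` and maps `φ` (here `φ i` is the paper's `φ_{i+1}`). -/
def gnnLabel (q : ℝ) (dims : ℕ → ℕ)
    (φ : (i : ℕ) → EuclideanSpace ℝ (Fin (dims i)) → EuclideanSpace ℝ (Fin (dims (i + 1))))
    (G : LabeledGraph (dims 0)) : (i : ℕ) → Fin G.n → EuclideanSpace ℝ (Fin (dims i))
  | 0, v => G.label v
  | i + 1, v =>
    if 0 < G.deg v then
      q • φ i (gnnLabel q dims φ G i v) +
        ((1 - q) / G.deg v) • ∑ v', G.w v v' • φ i (gnnLabel q dims φ G i v')
    else φ i (gnnLabel q dims φ G i v)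

/-- The output of a `k`-layer MP-GNN with damping `q`:
`h(G) = ψ( Σ_v (d̄eg(v)/Σ d̄eg) φ_{k+1}(ℓ_G^k(v)) )`. -/
def gnnOut (q : ℝ) (dims : ℕ → ℕ) (k : ℕ)
    (φ : (i : ℕ) → EuclideanSpace ℝ (Fin (dims i)) → EuclideanSpace ℝ (Fin (dims (i + 1))))
    (ψ : EuclideanSpace ℝ (Fin (dims (k + 1))) → ℝ)
    (G : LabeledGraph (dims 0)) : ℝ :=
  ψ (∑ v, G.statMeas v • φ k (gnnLabel q dims φ G k v))

end

/-- Compactness (in the sequentially compact form, equivalent to compactness for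
pseudometric spaces) of a set `K` with respect to a pseudo-distance function `dd`. -/
def SeqCompactIn {A : Type*} (dd : A → A → ℝ) (K : Set A) : Prop :=
  ∀ u : ℕ → A, (∀ n, u n ∈ K) → ∃ a ∈ K, ∃ s : ℕ → ℕ, StrictMono s ∧
    Filter.Tendsto (fun n => dd (u (s n)) a) Filter.atTop (nhds 0)

/-- Continuity of `f` on `K` with respect to the pseudo-distance `dd`. -/
def ContinuousOnPD {A : Type*} (dd : A → A → ℝ) (K : Set A) (f : A → ℝ) : Prop :=
  ∀ a ∈ K, ∀ ε > 0, ∃ δ > 0, ∀ b ∈ K, dd a b < δ → |f a - f b| < ε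

/-!
STATEMENT 14 (Universal approximation of `k`-layer MP-GNNs): Fix `q ∈ (0,1)`, `d ≥ 1` and
`k ∈ ℕ`, and let `K` be a compact subset of the pseudometric space `(𝒢(ℝ^d), d_{G,q}^{(k)})`.
Then the restrictions to `K` of `k`-layer MP-GNNs with damping `q` are dense in `C(K,ℝ)`
with respect to the supremum norm (so that the closure of `NN_k^q(ℝ^d)|_K` is `C(K,ℝ)`):
every continuous real-valued function on `K` can be uniformly approximated by such MP-GNNs.
-/
theorem exists_approx_of_lattice {X : Type*} [TopologicalSpace X] [CompactSpace X]
    (L : Set (X → ℝ)) (hcont : ∀ g ∈ L, Continuous g)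
    (hconst : ∀ c : ℝ, (fun _ => c) ∈ L)
    (hinf : ∀ g ∈ L, ∀ h ∈ L, (fun x => min (g x) (h x)) ∈ L)
    (hsup : ∀ g ∈ L, ∀ h ∈ L, (fun x => max (g x) (h x)) ∈ L)
    (hsep : ∀ x y, ¬ Inseparable x y → ∀ a b : ℝ, ∃ g ∈ L, g x = a ∧ g y = b)
    (f : X → ℝ) (hf : Continuous f) (ε : ℝ) (hε : 0 < ε) :
    ∃ g ∈ L, ∀ x, |f x - g x| < ε := by
  have hresp : ∀ g : X → ℝ, Continuous g → ∀ x y, Inseparable x y → g x = g y :=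
    fun g hg x y h => (h.map hg).eq
  have : CompactSpace (SeparationQuotient X) := Quotient.compactSpace
  let L' : Set C(SeparationQuotient X, ℝ) := {G | (fun x => G (SeparationQuotient.mk x)) ∈ L}
  have hlift : ∀ g ∈ L, ∃ G ∈ L', ∀ x, G (SeparationQuotient.mk x) = g x := fun g hg =>
    ⟨⟨SeparationQuotient.lift g (hresp g (hcont g hg)),
      SeparationQuotient.continuous_lift (hcont g hg)⟩, hg, fun x => rfl⟩
  have htop : closure L' = ⊤ := by
    refine ContinuousMap.sublattice_closure_eq_top L' ?_
      (fun g hg h hh => hinf _ hg _ hh) (fun g hg h hh => hsup _ hg _ hh) ?_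
    · obtain ⟨G, hG, -⟩ := hlift _ (hconst 0)
      exact ⟨G, hG⟩
    · intro v x y
      obtain ⟨x, rfl⟩ := SeparationQuotient.surjective_mk x
      obtain ⟨y, rfl⟩ := SeparationQuotient.surjective_mk y
      by_cases hxy : Inseparable x y
      · obtain ⟨G, hG, h⟩ := hlift _ (hconst (v (SeparationQuotient.mk x)))
        refine ⟨G, hG, h x, ?_⟩
        rw [← SeparationQuotient.mk_eq_mk.2 hxy]
        exact h x
      · obtain ⟨g, hg, hx, hy⟩ := hsep x y hxy (v (SeparationQuotient.mk x))
          (v (SeparationQuotient.mk y))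
        obtain ⟨G, hG, h⟩ := hlift g hg
        exact ⟨G, hG, (h x).trans hx, (h y).trans hy⟩
  let F : C(SeparationQuotient X, ℝ) :=
    ⟨SeparationQuotient.lift f (hresp f hf), SeparationQuotient.continuous_lift hf⟩
  have hF : F ∈ closure L' := by rw [htop]; trivial
  obtain ⟨G, hG, hd⟩ := Metric.mem_closure_iff.1 hF ε hε
  refine ⟨_, hG, fun x => ?_⟩
  have := (ContinuousMap.dist_lt_iff hε).1 hd (SeparationQuotient.mk x)
  rwa [Real.dist_eq] at this

/-- The largest pseudometric below a nonnegative function `dd`. -/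
noncomputable abbrev lowerPseudoMetric {X : Type*} (dd : X → X → ℝ) (h0 : ∀ x y, 0 ≤ dd x y) :
    PseudoMetricSpace X :=
  let S := {g : X → ℝ // ∀ x y, |g x - g y| ≤ dd x y}
  have : Nonempty S := ⟨⟨fun _ => 0, fun x y => by simpa using h0 x y⟩⟩
  have hb : ∀ x y, BddAbove (Set.range fun g : S => |g.1 x - g.1 y|) := fun x y =>
    ⟨dd x y, by rintro _ ⟨g, rfl⟩; exact g.2 x y⟩
  { dist := fun x y => ⨆ g : S, |g.1 x - g.1 y|
    dist_self := fun x => by simp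
    dist_comm := fun x y => by simp only [abs_sub_comm]
    dist_triangle := fun x y z => ciSup_le fun g =>
      (abs_sub_le _ (g.1 y) _).trans (add_le_add (le_ciSup (hb x y) g) (le_ciSup (hb y z) g)) }

theorem exists_approx_of_seqCompact {X : Type*} (dd : X → X → ℝ) (h0 : ∀ x y, 0 ≤ dd x y)
    (hsymm : ∀ x y, dd x y = dd y x)
    (K : Set X) (hK : SeqCompactIn dd K)
    (L : Set (X → ℝ)) (hlip : ∀ g ∈ L, ∃ C : ℝ, ∀ x y, |g x - g y| ≤ C * dd x y)
    (hconst : ∀ c : ℝ, (fun _ => c) ∈ L)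
    (hinf : ∀ g ∈ L, ∀ h ∈ L, (fun x => min (g x) (h x)) ∈ L)
    (hsup : ∀ g ∈ L, ∀ h ∈ L, (fun x => max (g x) (h x)) ∈ L)
    (hsep : ∀ x y, dd x y ≠ 0 → ∀ a b : ℝ, ∃ g ∈ L, g x = a ∧ g y = b)
    (f : X → ℝ) (hf : ContinuousOnPD dd K f) (ε : ℝ) (hε : 0 < ε) :
    ∃ g ∈ L, ∀ x ∈ K, |f x - g x| < ε := by
  let _ : PseudoMetricSpace X := lowerPseudoMetric dd h0
  have : Nonempty {g : X → ℝ // ∀ x y, |g x - g y| ≤ dd x y} :=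
    ⟨⟨fun _ => 0, fun x y => by simpa using h0 x y⟩⟩
  have hle : ∀ x y, dist x y ≤ dd x y := fun x y => ciSup_le fun g => g.2 x y
  have hge : ∀ (g : X → ℝ), (∀ x y, |g x - g y| ≤ dd x y) → ∀ x y, |g x - g y| ≤ dist x y := by
    intro g hg x y
    exact le_ciSup (f := fun g : {g : X → ℝ // ∀ x y, |g x - g y| ≤ dd x y} => |g.1 x - g.1 y|)
      ⟨dd x y, by rintro _ ⟨g, rfl⟩; exact g.2 x y⟩ ⟨g, hg⟩
  have hlip' : ∀ g ∈ L, ∃ C : ℝ, 0 < C ∧ ∀ x y, |g x - g y| ≤ C * dist x y := by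
    intro g hg
    obtain ⟨C, hC⟩ := hlip g hg
    have hpos : 0 < |C| + 1 := by positivity
    refine ⟨|C| + 1, hpos, fun x y => ?_⟩
    have := hge (fun x => g x / (|C| + 1)) (fun x y => by
      rw [← sub_div, abs_div, abs_of_pos hpos, div_le_iff₀ hpos]
      nlinarith [hC x y, h0 x y, le_abs_self C]) x y
    rw [← sub_div, abs_div, abs_of_pos hpos, div_le_iff₀ hpos] at this
    linarith
  have hcont : ∀ g ∈ L, Continuous g := by
    intro g hg
    obtain ⟨C, -, hC⟩ := hlip' g hg
    exact (LipschitzWith.of_dist_le' (K := C) hC).continuous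
  have hzero : ∀ x y, dist x y = 0 → dd x y = 0 := by
    intro x y hxy
    by_contra hne
    obtain ⟨g, hg, hx, hy⟩ := hsep x y hne 0 1
    have h := ((Metric.inseparable_iff.2 hxy).map (hcont g hg)).eq
    rw [hx, hy] at h
    norm_num at h
  have htend : ∀ (u : ℕ → K) (a : K),
      Filter.Tendsto (fun n => dd (u n) a) Filter.atTop (nhds 0) →
      Filter.Tendsto u Filter.atTop (nhds a) := fun u a h =>
    tendsto_iff_dist_tendsto_zero.2
      (squeeze_zero (fun n => dist_nonneg) (fun n => hle (u n) a) h)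
  have hsc : SeqCompactSpace K := by
    refine ⟨fun u _ => ?_⟩
    obtain ⟨a, ha, s, hs, h⟩ := hK (fun n => u n) fun n => (u n).2
    exact ⟨⟨a, ha⟩, trivial, s, hs, htend (u ∘ s) ⟨a, ha⟩ h⟩
  have hcs : CompactSpace K := compactSpace_iff_seqCompactSpace.2 hsc
  have hfc : Continuous fun x : K => f x := by
    refine continuous_iff_seqContinuous.2 fun x a hx => ?_
    refine Filter.tendsto_of_subseq_tendsto fun ns hns => ?_
    obtain ⟨b, hb, s, hs, h⟩ := hK (fun n => x (ns n)) fun n => (x (ns n)).2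
    refine ⟨s, ?_⟩
    have hab : f b = f a := by
      have h1 := htend (fun n => x (ns (s n))) ⟨b, hb⟩ h
      have h2 := hx.comp (hns.comp hs.tendsto_atTop)
      have h3 : dd b a = 0 :=
        hzero _ _ (Metric.inseparable_iff.1 (tendsto_nhds_unique_inseparable h1 h2) :
          dist (⟨b, hb⟩ : K) a = 0)
      by_contra hne
      obtain ⟨δ, hδ, H⟩ := hf b hb _ (abs_pos.2 (sub_ne_zero.2 hne))
      exact lt_irrefl _ (H a a.2 (h3 ▸ hδ))
    change Filter.Tendsto _ _ (nhds (f a))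
    rw [← hab]
    refine Metric.tendsto_nhds.2 fun η hη => ?_
    obtain ⟨δ, hδ, H⟩ := hf b hb η hη
    filter_upwards [h.eventually (gt_mem_nhds hδ)] with n hn
    rw [dist_comm]
    exact H _ (x (ns (s n))).2 (hsymm b _ ▸ hn)
  obtain ⟨g, ⟨g', hg', rfl⟩, h⟩ := exists_approx_of_lattice
    (X := K) {g | ∃ g' ∈ L, g = fun x : K => g' x}
    (by rintro _ ⟨g, hg, rfl⟩; exact (hcont g hg).comp continuous_subtype_val)
    (fun c => ⟨_, hconst c, rfl⟩)
    (by rintro _ ⟨g, hg, rfl⟩ _ ⟨h, hh, rfl⟩; exact ⟨_, hinf g hg h hh, rfl⟩)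
    (by rintro _ ⟨g, hg, rfl⟩ _ ⟨h, hh, rfl⟩; exact ⟨_, hsup g hg h hh, rfl⟩)
    (fun x y hxy a b => by
      have : dd x y ≠ 0 := fun h => hxy (Metric.inseparable_iff.2
        (le_antisymm ((hle x y).trans h.le) dist_nonneg))
      obtain ⟨g, hg, hx, hy⟩ := hsep x y this a b
      exact ⟨_, ⟨g, hg, rfl⟩, hx, hy⟩)
    (fun x => f x) hfc ε hε
  exact ⟨g', hg', fun x hx => h ⟨x, hx⟩⟩

namespace LabeledGraph

variable {d : ℕ} (G : LabeledGraph d)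

theorem deg_nonneg (v : Fin G.n) : 0 ≤ G.deg v := sum_nonneg fun _ _ => G.w_nonneg _ _

theorem dbar_pos (v : Fin G.n) : 0 < G.dbar v := by
  unfold dbar
  split_ifs with h
  · exact h
  · exact one_pos

theorem sum_dbar_pos : 0 < ∑ v, G.dbar v :=
  sum_pos (fun v _ => G.dbar_pos v) ⟨⟨0, G.n_pos⟩, mem_univ _⟩

theorem statMeas_nonneg (v : Fin G.n) : 0 ≤ G.statMeas v :=
  div_nonneg (G.dbar_pos v).le G.sum_dbar_pos.le

theorem sum_statMeas : ∑ v, G.statMeas v = 1 := by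
  simp only [statMeas, ← sum_div]
  exact div_self G.sum_dbar_pos.ne'

theorem kernel_nonneg {q : ℝ} (hq0 : 0 ≤ q) (hq1 : q ≤ 1) (v v' : Fin G.n) :
    0 ≤ G.kernel q v v' := by
  unfold kernel
  have := G.w_nonneg v v'
  have : 0 ≤ 1 - q := sub_nonneg.2 hq1
  split_ifs <;> positivity

theorem sum_kernel_smul {E : Type*} [AddCommGroup E] [Module ℝ E] (q : ℝ) (v : Fin G.n)
    (u : Fin G.n → E) :
    ∑ v', G.kernel q v v' • u v' =
      if 0 < G.deg v then q • u v + ((1 - q) / G.deg v) • ∑ v', G.w v v' • u v' else u v := by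
  unfold kernel
  split_ifs with h
  · simp only [add_smul, sum_add_distrib, ite_smul, zero_smul, sum_ite_eq', mem_univ, if_true,
      smul_sum, smul_smul]
    congr 1
    refine sum_congr rfl fun v' _ => ?_
    congr 1
    ring
  · simp

theorem sum_kernel (q : ℝ) (v : Fin G.n) : ∑ v', G.kernel q v v' = 1 := by
  have h := G.sum_kernel_smul q v fun _ => (1 : ℝ)
  simp only [smul_eq_mul, mul_one] at h
  rw [h]
  split_ifs with hd
  · change q + (1 - q) / G.deg v * G.deg v = 1
    field_simp
    ring
  · rfl

end LabeledGraph

theorem gnnLabel_succ (q : ℝ) (dims : ℕ → ℕ)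
    (φ : (i : ℕ) → EuclideanSpace ℝ (Fin (dims i)) → EuclideanSpace ℝ (Fin (dims (i + 1))))
    (G : LabeledGraph (dims 0)) (i : ℕ) (v : Fin G.n) :
    gnnLabel q dims φ G (i + 1) v =
      ∑ v', G.kernel q v v' • φ i (gnnLabel q dims φ G i v') := by
  rw [LabeledGraph.sum_kernel_smul, gnnLabel]

section Couplings

variable {A B : Type*} [Fintype A] [Fintype B]

theorem dist_sum_smul_le_of_isCouplingFn {E : Type*} [NormedAddCommGroup E] [NormedSpace ℝ E]
    {p : A → ℝ} {p' : B → ℝ} {π : A × B → ℝ} (h : IsCouplingFn π p p') (u : A → E) (u' : B → E) :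
    dist (∑ a, p a • u a) (∑ b, p' b • u' b) ≤ ∑ r, π r * dist (u r.1) (u' r.2) := by
  have h1 : ∑ a, p a • u a = ∑ r, π r • u r.1 := by
    rw [Fintype.sum_prod_type]
    simp only [← sum_smul, h.2.1]
  have h2 : ∑ b, p' b • u' b = ∑ r, π r • u' r.2 := by
    rw [Fintype.sum_prod_type_right]
    simp only [← sum_smul, h.2.2]
  rw [h1, h2]
  refine (dist_sum_sum_le _ _ _).trans (sum_le_sum fun r _ => ?_)
  rw [dist_smul₀, Real.norm_of_nonneg (h.1 r)]

/-- Two finite measures whose pushforwards under `hA` and `hB` agree admit a coupling supported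
on `{(a, b) | hA a = hB b}`. -/
theorem exists_isCouplingFn_of_fiber_sums {C : Type*} [DecidableEq C]
    {p : A → ℝ} {p' : B → ℝ} (hp : ∀ a, 0 ≤ p a) (hp' : ∀ b, 0 ≤ p' b) (hA : A → C) (hB : B → C)
    (hfib : ∀ c, (∑ a, if hA a = c then p a else 0) = ∑ b, if hB b = c then p' b else 0) :
    ∃ π, IsCouplingFn π p p' ∧ ∀ r, π r ≠ 0 → hA r.1 = hB r.2 := by
  set S : C → ℝ := fun c => ∑ a, if hA a = c then p a else 0 with hS
  have hS0 : ∀ c, 0 ≤ S c := fun c => sum_nonneg fun a _ => by split_ifs <;> simp [hp]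
  have hle : ∀ a, p a ≤ S (hA a) := fun a => by
    have := single_le_sum (f := fun a' => if hA a' = hA a then p a' else 0)
      (fun a' _ => by split_ifs <;> simp [hp]) (mem_univ a)
    simpa using this
  have hle' : ∀ b, p' b ≤ S (hB b) := fun b => by
    have := single_le_sum (f := fun b' => if hB b' = hB b then p' b' else 0)
      (fun b' _ => by split_ifs <;> simp [hp']) (mem_univ b)
    rw [show S (hB b) = _ from hfib _]
    simpa using this
  have key : ∀ x s : ℝ, 0 ≤ x → x ≤ s → x * s / s = x := fun x s hx hxs => by
    rcases eq_or_ne s 0 with rfl | hs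
    · simp [le_antisymm hxs hx]
    · exact mul_div_cancel_right₀ x hs
  refine ⟨fun r => if hA r.1 = hB r.2 then p r.1 * p' r.2 / S (hB r.2) else 0,
    ⟨fun r => ?_, fun a => ?_, fun b => ?_⟩, fun r hr => ?_⟩
  · have := hp r.1
    have := hp' r.2
    have := hS0 (hB r.2)
    dsimp only
    split_ifs <;> positivity
  · calc _ = p a * (∑ b, if hB b = hA a then p' b else 0) / S (hA a) := by
          rw [mul_sum, sum_div]
          refine sum_congr rfl fun b _ => ?_
          by_cases h : hA a = hB b
          · simp [h]
          · simp [h, Ne.symm h]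
      _ = p a := by rw [← hfib]; exact key _ _ (hp a) (hle a)
  · calc _ = p' b * S (hB b) / S (hB b) := by
          rw [hS, mul_sum, sum_div]
          refine sum_congr rfl fun a _ => ?_
          by_cases h : hA a = hB b
          · simp [h, mul_comm]
          · simp [h]
      _ = p' b := key _ _ (hp' b) (hle' b)
  · by_contra h
    simp [h] at hr

theorem exists_isCouplingFn {p : A → ℝ} {p' : B → ℝ} (hp : ∀ a, 0 ≤ p a) (hp' : ∀ b, 0 ≤ p' b)
    (h : ∑ a, p a = ∑ b, p' b) : ∃ π, IsCouplingFn π p p' := by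
  obtain ⟨π, hπ, -⟩ := exists_isCouplingFn_of_fiber_sums hp hp' (fun _ => ()) (fun _ => ())
    (by simpa using h)
  exact ⟨π, hπ⟩

theorem IsCouplingFn.swap {p : A → ℝ} {p' : B → ℝ} {π : A × B → ℝ} (h : IsCouplingFn π p p') :
    IsCouplingFn (fun r => π r.swap) p' p :=
  ⟨fun r => h.1 r.swap, h.2.2, h.2.1⟩

variable [DecidableEq A] [DecidableEq B] {mA : A → A → ℝ} {mB : B → B → ℝ}

theorem IsKStepCoupling.nonneg {k : ℕ} {ν : A × B → A × B → ℝ} (h : IsKStepCoupling mA mB k ν) :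
    ∀ p r, 0 ≤ ν p r := by
  induction h with
  | zero ν h => intro p r; rw [h]; split_ifs <;> simp
  | one ν h => exact fun p r => (h p).1 r
  | succ k ν' ν₁ ν h' h₁ h ih =>
    intro p r
    rw [h]
    exact sum_nonneg fun s _ => mul_nonneg ((h₁ p).1 s) (ih s r)

theorem IsKStepCoupling.swap {k : ℕ} {ν : A × B → A × B → ℝ} (h : IsKStepCoupling mA mB k ν) :
    IsKStepCoupling mB mA k (fun p r => ν p.swap r.swap) := by
  induction h with
  | zero ν h =>
    refine .zero _ fun p r => ?_
    rw [h]
    simp only [Prod.swap_inj]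
  | one ν h => exact .one _ fun p => (h p.swap).swap
  | succ k ν' ν₁ ν h' h₁ h ih =>
    refine .succ k _ _ _ ih (fun p => (h₁ p.swap).swap) fun p r => ?_
    rw [h]
    exact (Equiv.sum_comp (Equiv.prodComm B A) _).symm

/-- A function of the layer features of depth `i` is controlled by the `i`-step transport cost. -/
theorem IsKStepCoupling.le_mul_cost {k : ℕ} {ν : A × B → A × B → ℝ}
    (h : IsKStepCoupling mA mB k ν) (D : ℕ → A × B → ℝ) (c : ℕ → ℝ) (hc : ∀ i, 0 ≤ c i)
    (hD : ∀ i p π, IsCouplingFn π (mA p.1) (mB p.2) → D (i + 1) p ≤ c i * ∑ r, π r * D i r) :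
    ∀ p, D k p ≤ (∏ i ∈ range k, c i) * ∑ r, ν p r * D 0 r := by
  induction h with
  | zero ν h => intro p; simp [h]
  | one ν h => intro p; simpa using hD 0 p _ (h p)
  | succ k ν' ν₁ ν h' h₁ h ih =>
    intro p
    calc D (k + 1) p ≤ c k * ∑ s, ν₁ p s * D k s := hD k p _ (h₁ p)
      _ ≤ c k * ∑ s, ν₁ p s * ((∏ i ∈ range k, c i) * ∑ r, ν' s r * D 0 r) := by
        refine mul_le_mul_of_nonneg_left (sum_le_sum fun s _ => ?_) (hc k)
        exact mul_le_mul_of_nonneg_left (ih s) ((h₁ p).1 s)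
      _ = _ := by
        simp only [h, prod_range_succ, sum_mul, mul_sum]
        rw [sum_comm]
        refine sum_congr rfl fun s _ => sum_congr rfl fun r _ => ?_
        ring

theorem exists_isKStepCoupling_supported {C : ℕ → Type*} [∀ i, DecidableEq (C i)]
    (hA : ∀ a a', 0 ≤ mA a a') (hB : ∀ b b', 0 ≤ mB b b')
    (hA1 : ∀ a, ∑ a', mA a a' = 1) (hB1 : ∀ b, ∑ b', mB b b' = 1)
    (lA : ∀ i, A → C i) (lB : ∀ i, B → C i)
    (h : ∀ i a b, lA (i + 1) a = lB (i + 1) b → ∀ c,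
      (∑ a', if lA i a' = c then mA a a' else 0) = ∑ b', if lB i b' = c then mB b b' else 0)
    (k : ℕ) :
    ∃ ν, IsKStepCoupling mA mB k ν ∧
      ∀ p, lA k p.1 = lB k p.2 → ∀ r, ν p r ≠ 0 → lA 0 r.1 = lB 0 r.2 := by
  induction k with
  | zero =>
    refine ⟨fun p r => if r = p then 1 else 0, .zero _ fun _ _ => rfl, fun p hp r hr => ?_⟩
    obtain rfl : r = p := by by_contra hne; simp [hne] at hr
    exact hp
  | succ k ih =>
    obtain ⟨ν', hν', hsupp⟩ := ih
    have hstep : ∀ p : A × B, ∃ π, IsCouplingFn π (mA p.1) (mB p.2) ∧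
        (lA (k + 1) p.1 = lB (k + 1) p.2 → ∀ r, π r ≠ 0 → lA k r.1 = lB k r.2) := by
      intro p
      by_cases hp : lA (k + 1) p.1 = lB (k + 1) p.2
      · obtain ⟨π, hπ, hs⟩ := exists_isCouplingFn_of_fiber_sums (hA p.1) (hB p.2) (lA k) (lB k)
          (h k _ _ hp)
        exact ⟨π, hπ, fun _ => hs⟩
      · obtain ⟨π, hπ⟩ := exists_isCouplingFn (hA p.1) (hB p.2) ((hA1 _).trans (hB1 _).symm)
        exact ⟨π, hπ, fun h => absurd h hp⟩
    choose ν₁ hν₁ hs₁ using hstep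
    refine ⟨_, .succ k ν' ν₁ _ hν' hν₁ fun _ _ => rfl, fun p hp r hr => ?_⟩
    obtain ⟨s, -, hs⟩ := exists_ne_zero_of_sum_ne_zero hr
    exact hsupp s (hs₁ p hp s (left_ne_zero_of_mul hs)) r (right_ne_zero_of_mul hs)

end Couplings

theorem dGq_nonneg {d : ℕ} (q : ℝ) (k : ℕ) (G H : LabeledGraph d) : 0 ≤ dGq q k G H := by
  refine Real.sInf_nonneg ?_
  rintro _ ⟨γ, ν, hγ, hν, rfl⟩
  exact sum_nonneg fun p _ => mul_nonneg
    (sum_nonneg fun s _ => mul_nonneg (hγ.1 s) (hν.nonneg s p)) dist_nonneg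

theorem dGq_le_of_coupling {d : ℕ} {q : ℝ} {k : ℕ} {G H : LabeledGraph d}
    {γ : Fin G.n × Fin H.n → ℝ} {ν : Fin G.n × Fin H.n → Fin G.n × Fin H.n → ℝ}
    (hγ : IsCouplingFn γ G.statMeas H.statMeas)
    (hν : IsKStepCoupling (G.kernel q) (H.kernel q) k ν) :
    dGq q k G H ≤ ∑ p : Fin G.n × Fin H.n, odotFn ν γ p * dist (G.label p.1) (H.label p.2) := by
  refine csInf_le ⟨0, ?_⟩ ⟨γ, ν, hγ, hν, rfl⟩
  rintro _ ⟨γ, ν, hγ, hν, rfl⟩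
  exact sum_nonneg fun p _ => mul_nonneg
    (sum_nonneg fun s _ => mul_nonneg (hγ.1 s) (hν.nonneg s p)) dist_nonneg

theorem exists_dGq_coupling {d : ℕ} {q : ℝ} (hq0 : 0 ≤ q) (hq1 : q ≤ 1) (k : ℕ)
    (G H : LabeledGraph d) :
    ∃ γ ν, IsCouplingFn γ G.statMeas H.statMeas ∧
      IsKStepCoupling (G.kernel q) (H.kernel q) k ν := by
  obtain ⟨γ, hγ⟩ := exists_isCouplingFn G.statMeas_nonneg H.statMeas_nonneg
    (G.sum_statMeas.trans H.sum_statMeas.symm)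
  obtain ⟨ν, hν, -⟩ := exists_isKStepCoupling_supported (C := fun _ => ℕ)
    (G.kernel_nonneg hq0 hq1) (H.kernel_nonneg hq0 hq1) (G.sum_kernel q) (H.sum_kernel q)
    (fun _ _ => 0) (fun i _ => i) (fun i _ _ h => absurd h (Nat.succ_ne_zero i).symm) k
  exact ⟨γ, ν, hγ, hν⟩

theorem dGq_comm {d : ℕ} {q : ℝ} (hq0 : 0 ≤ q) (hq1 : q ≤ 1) (k : ℕ) (G H : LabeledGraph d) :
    dGq q k G H = dGq q k H G := by
  have key : ∀ G H : LabeledGraph d, dGq q k G H ≤ dGq q k H G := by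
    intro G H
    obtain ⟨γ, ν, hγ, hν⟩ := exists_dGq_coupling hq0 hq1 k H G
    refine le_csInf ⟨_, γ, ν, hγ, hν, rfl⟩ ?_
    rintro _ ⟨γ, ν, hγ, hν, rfl⟩
    refine (dGq_le_of_coupling hγ.swap hν.swap).trans_eq ?_
    rw [← Equiv.sum_comp (Equiv.prodComm (Fin H.n) (Fin G.n))]
    refine sum_congr rfl fun p _ => ?_
    rw [dist_comm]
    congr 1
    exact Equiv.sum_comp (Equiv.prodComm (Fin G.n) (Fin H.n)) fun s => γ s * ν s p
  exact le_antisymm (key G H) (key H G)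

/-- The aggregated graph feature of an MP-GNN, to which the readout map is applied. -/
noncomputable def gnnFeature (q : ℝ) (dims : ℕ → ℕ) (k : ℕ)
    (φ : (i : ℕ) → EuclideanSpace ℝ (Fin (dims i)) → EuclideanSpace ℝ (Fin (dims (i + 1))))
    (G : LabeledGraph (dims 0)) : EuclideanSpace ℝ (Fin (dims (k + 1))) :=
  ∑ v, G.statMeas v • φ k (gnnLabel q dims φ G k v)

theorem exists_dist_gnnFeature_le {q : ℝ} (hq0 : 0 ≤ q) (hq1 : q ≤ 1) (dims : ℕ → ℕ) (k : ℕ)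
    (φ : (i : ℕ) → EuclideanSpace ℝ (Fin (dims i)) → EuclideanSpace ℝ (Fin (dims (i + 1))))
    (hφ : ∀ i, ∃ c : NNReal, LipschitzWith c (φ i)) :
    ∃ C : ℝ, 0 ≤ C ∧ ∀ G H : LabeledGraph (dims 0),
      dist (gnnFeature q dims k φ G) (gnnFeature q dims k φ H) ≤ C * dGq q k G H := by
  choose c hc using hφ
  have hC : (0 : ℝ) < ∏ i ∈ range (k + 1), (c i : ℝ) + 1 := by positivity
  refine ⟨∏ i ∈ range (k + 1), (c i : ℝ) + 1, hC.le, fun G H => ?_⟩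
  obtain ⟨γ, ν, hγ, hν⟩ := exists_dGq_coupling hq0 hq1 k G H
  rw [← div_le_iff₀' hC]
  refine le_csInf ⟨_, γ, ν, hγ, hν, rfl⟩ ?_
  rintro _ ⟨γ, ν, hγ, hν, rfl⟩
  rw [div_le_iff₀' hC]
  let D : ℕ → Fin G.n × Fin H.n → ℝ := fun i p =>
    dist (gnnLabel q dims φ G i p.1) (gnnLabel q dims φ H i p.2)
  have hD : ∀ p, D k p ≤ (∏ i ∈ range k, (c i : ℝ)) * ∑ r, ν p r * D 0 r := by
    refine hν.le_mul_cost D (fun i => c i) (fun i => (c i).2) fun i p π hπ => ?_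
    simp only [D, gnnLabel_succ]
    refine (dist_sum_smul_le_of_isCouplingFn hπ _ _).trans ?_
    rw [mul_sum]
    refine sum_le_sum fun r _ => ?_
    rw [mul_left_comm]
    exact mul_le_mul_of_nonneg_left ((hc i).dist_le_mul _ _) (hπ.1 r)
  have hcost : 0 ≤ ∑ p : Fin G.n × Fin H.n, odotFn ν γ p * dist (G.label p.1) (H.label p.2) :=
    sum_nonneg fun p _ => mul_nonneg
      (sum_nonneg fun s _ => mul_nonneg (hγ.1 s) (hν.nonneg s p)) dist_nonneg
  calc dist (gnnFeature q dims k φ G) (gnnFeature q dims k φ H)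
      ≤ ∑ p, γ p * dist (φ k (gnnLabel q dims φ G k p.1)) (φ k (gnnLabel q dims φ H k p.2)) :=
        dist_sum_smul_le_of_isCouplingFn hγ _ _
    _ ≤ ∑ p, γ p * (c k * ((∏ i ∈ range k, (c i : ℝ)) * ∑ r, ν p r * D 0 r)) := by
        refine sum_le_sum fun p _ => mul_le_mul_of_nonneg_left ?_ (hγ.1 p)
        exact ((hc k).dist_le_mul _ _).trans (mul_le_mul_of_nonneg_left (hD p) (c k).2)
    _ = (∏ i ∈ range (k + 1), (c i : ℝ)) *
          ∑ p : Fin G.n × Fin H.n, odotFn ν γ p * dist (G.label p.1) (H.label p.2) := by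
        simp only [odotFn, prod_range_succ, sum_mul, mul_sum]
        rw [sum_comm]
        refine sum_congr rfl fun s _ => sum_congr rfl fun r _ => ?_
        simp only [D, gnnLabel]
        ring
    _ ≤ _ := mul_le_mul_of_nonneg_right (by linarith) hcost

theorem exists_lipschitzWith_toLp {X : Type*} [PseudoMetricSpace X] {N : ℕ} (f : Fin N → X → ℝ)
    (hf : ∀ j, ∃ c : NNReal, LipschitzWith c (f j)) :
    ∃ c : NNReal, LipschitzWith c
      (fun x => (WithLp.toLp 2 fun j => f j x : EuclideanSpace ℝ (Fin N))) := by
  choose c hc using hf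
  have h : LipschitzWith (univ.sup c) fun x j => f j x := by
    refine LipschitzWith.of_dist_le_mul fun x y => ?_
    refine (dist_pi_le_iff (by positivity)).2 fun j => ((hc j).dist_le_mul x y).trans ?_
    exact mul_le_mul_of_nonneg_right (NNReal.coe_le_coe.2 (le_sup (mem_univ j))) dist_nonneg
  exact ⟨_, (PiLp.lipschitzWith_toLp 2 fun _ : Fin N => ℝ).comp h⟩

/-- A Lipschitz map sending finitely many points to scaled indicators of equality. -/
theorem exists_lipschitz_indicator {X : Type*} [MetricSpace X] [DecidableEq X] {N : ℕ} (L : Fin N → X) :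
    ∃ φ : X → EuclideanSpace ℝ (Fin N), (∃ c : NNReal, LipschitzWith c φ) ∧
      ∃ r : ℝ, 0 < r ∧ ∀ i j, φ (L i) j = if L i = L j then r else 0 := by
  have h : ∀ᶠ r : ℝ in nhdsWithin 0 (Set.Ioi 0), ∀ p : Fin N × Fin N,
      L p.1 ≠ L p.2 → r ≤ dist (L p.1) (L p.2) := by
    refine Filter.eventually_all.2 fun p => ?_
    by_cases hp : L p.1 = L p.2
    · simp [hp]
    · filter_upwards [nhdsWithin_le_nhds (Iio_mem_nhds (dist_pos.2 hp))] with r hr _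
      exact le_of_lt hr
  obtain ⟨r, hr, hr0⟩ := (h.and self_mem_nhdsWithin).exists
  refine ⟨_, exists_lipschitzWith_toLp (fun j x => max 0 (r - dist x (L j))) fun j =>
    ⟨1, LipschitzWith.const_max (.of_le_add fun x y => ?_) 0⟩, r, hr0, fun i j => ?_⟩
  · linarith [dist_triangle_left y (L j) x]
  · by_cases hij : L i = L j
    · simpa [hij] using le_of_lt hr0
    · simpa [hij] using hr (i, j) hij

theorem fiber_sums_eq_of_indicator {X : Type*} [DecidableEq X] {m n : ℕ} {r : ℝ} (hr : 0 < r)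
    (L : Fin (m + n) → X) (φ : X → EuclideanSpace ℝ (Fin (m + n)))
    (hφ : ∀ i j, φ (L i) j = if L i = L j then r else 0) (p : Fin m → ℝ) (p' : Fin n → ℝ)
    (h : ∑ a, p a • φ (L (Fin.castAdd n a)) = ∑ b, p' b • φ (L (Fin.natAdd m b))) (c : X) :
    (∑ a, if L (Fin.castAdd n a) = c then p a else 0) =
      ∑ b, if L (Fin.natAdd m b) = c then p' b else 0 := by
  by_cases hc : ∃ j, L j = c
  · obtain ⟨j, rfl⟩ := hc
    have hj := congrArg (fun x : EuclideanSpace ℝ (Fin (m + n)) => x j) h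
    simp only [WithLp.ofLp_sum, WithLp.ofLp_smul, Finset.sum_apply, Pi.smul_apply, smul_eq_mul,
      hφ, mul_ite, mul_zero] at hj
    refine mul_right_cancel₀ hr.ne' ?_
    simpa only [sum_mul, ite_mul, zero_mul] using hj
  · rw [not_exists] at hc
    simp [hc]

/-- The joint vertex features of two graphs under message passing whose maps are chosen, layer by
layer, by `step` from the current features. -/
noncomputable def pairLabels {d : ℕ} (q : ℝ) (G H : LabeledGraph d)
    (step : (m : ℕ) → (Fin (G.n + H.n) → EuclideanSpace ℝ (Fin m)) →
      EuclideanSpace ℝ (Fin m) → EuclideanSpace ℝ (Fin (G.n + H.n))) :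
    (i : ℕ) → Fin (G.n + H.n) → EuclideanSpace ℝ (Fin (dimSeq d (fun _ => G.n + H.n) i))
  | 0 => Fin.append G.label H.label
  | i + 1 =>
    Fin.append
      (fun v => ∑ v', G.kernel q v v' •
        step _ (pairLabels q G H step i) (pairLabels q G H step i (Fin.castAdd _ v')))
      (fun v => ∑ v', H.kernel q v v' •
        step _ (pairLabels q G H step i) (pairLabels q G H step i (Fin.natAdd _ v')))

theorem pairLabels_succ_castAdd {d : ℕ} (q : ℝ) (G H : LabeledGraph d)
    (step : (m : ℕ) → (Fin (G.n + H.n) → EuclideanSpace ℝ (Fin m)) →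
      EuclideanSpace ℝ (Fin m) → EuclideanSpace ℝ (Fin (G.n + H.n))) (i : ℕ) (v : Fin G.n) :
    pairLabels q G H step (i + 1) (Fin.castAdd _ v) = ∑ v', G.kernel q v v' •
      step _ (pairLabels q G H step i) (pairLabels q G H step i (Fin.castAdd _ v')) :=
  Fin.append_left (α := EuclideanSpace ℝ (Fin (G.n + H.n))) _ _ v

theorem pairLabels_succ_natAdd {d : ℕ} (q : ℝ) (G H : LabeledGraph d)
    (step : (m : ℕ) → (Fin (G.n + H.n) → EuclideanSpace ℝ (Fin m)) →
      EuclideanSpace ℝ (Fin m) → EuclideanSpace ℝ (Fin (G.n + H.n))) (i : ℕ) (v : Fin H.n) :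
    pairLabels q G H step (i + 1) (Fin.natAdd _ v) = ∑ v', H.kernel q v v' •
      step _ (pairLabels q G H step i) (pairLabels q G H step i (Fin.natAdd _ v')) :=
  Fin.append_right (α := EuclideanSpace ℝ (Fin (G.n + H.n))) _ _ v

theorem exists_gnnFeature_ne {d : ℕ} {q : ℝ} (hq0 : 0 ≤ q) (hq1 : q ≤ 1) (k : ℕ)
    (G H : LabeledGraph d) (hGH : dGq q k G H ≠ 0) :
    ∃ (t : ℕ → ℕ) (φ : (i : ℕ) → EuclideanSpace ℝ (Fin (dimSeq d t i)) →
        EuclideanSpace ℝ (Fin (dimSeq d t (i + 1)))),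
      (∀ i, ∃ c : NNReal, LipschitzWith c (φ i)) ∧
      gnnFeature q (dimSeq d t) k φ G ≠ gnnFeature q (dimSeq d t) k φ H := by
  classical
  have hex := fun (m : ℕ) (L : Fin (G.n + H.n) → EuclideanSpace ℝ (Fin m)) =>
    exists_lipschitz_indicator L
  choose step hlip r hr hstep using hex
  set t : ℕ → ℕ := fun _ => G.n + H.n
  let L := pairLabels q G H step
  let φ : (i : ℕ) → EuclideanSpace ℝ (Fin (dimSeq d t i)) →
    EuclideanSpace ℝ (Fin (dimSeq d t (i + 1))) := fun i => step _ (L i)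
  refine ⟨t, φ, fun i => hlip _ _, fun heq => hGH ?_⟩
  have hG : ∀ i v, gnnLabel q (dimSeq d t) φ G i v = L i (Fin.castAdd _ v) := by
    intro i
    induction i with
    | zero => exact fun v => (Fin.append_left _ _ v).symm
    | succ i ih =>
      exact fun v => (gnnLabel_succ q (dimSeq d t) φ G i v).trans
        ((sum_congr rfl fun v' _ => congrArg (fun x => G.kernel q v v' • φ i x) (ih v')).trans
          (pairLabels_succ_castAdd q G H step i v).symm)
  have hH : ∀ i v, gnnLabel q (dimSeq d t) φ H i v = L i (Fin.natAdd _ v) := by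
    intro i
    induction i with
    | zero => exact fun v => (Fin.append_right _ _ v).symm
    | succ i ih =>
      exact fun v => (gnnLabel_succ q (dimSeq d t) φ H i v).trans
        ((sum_congr rfl fun v' _ => congrArg (fun x => H.kernel q v v' • φ i x) (ih v')).trans
          (pairLabels_succ_natAdd q G H step i v).symm)
  obtain ⟨ν, hν, hsupp⟩ := exists_isKStepCoupling_supported
    (C := fun i => EuclideanSpace ℝ (Fin (dimSeq d t i)))
    (G.kernel_nonneg hq0 hq1) (H.kernel_nonneg hq0 hq1) (G.sum_kernel q) (H.sum_kernel q)
    (fun i a => L i (Fin.castAdd _ a)) (fun i b => L i (Fin.natAdd _ b))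
    (fun i a b hab => by
      refine fiber_sums_eq_of_indicator (hr _ (L i)) (L i) (step _ (L i)) (hstep _ _) _ _ ?_
      have h1 := gnnLabel_succ q (dimSeq d t) φ G i a
      have h2 := gnnLabel_succ q (dimSeq d t) φ H i b
      simp only [hG] at h1
      simp only [hH] at h2
      exact h1.symm.trans (hab.trans h2)) k
  obtain ⟨γ, hγ, hγs⟩ := exists_isCouplingFn_of_fiber_sums G.statMeas_nonneg H.statMeas_nonneg
    (fun a => L k (Fin.castAdd _ a)) (fun b => L k (Fin.natAdd _ b))
    (fiber_sums_eq_of_indicator (hr _ (L k)) (L k) (step _ (L k)) (hstep _ _) _ _ (by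
      simp only [gnnFeature, hG, hH] at heq
      exact heq))
  refine le_antisymm ((dGq_le_of_coupling hγ hν).trans_eq ?_) (dGq_nonneg _ _ _ _)
  refine sum_eq_zero fun p _ => ?_
  by_cases h : odotFn ν γ p = 0
  · rw [h, zero_mul]
  · obtain ⟨s, -, hs⟩ := exists_ne_zero_of_sum_ne_zero h
    have h0 : L 0 (Fin.castAdd _ p.1) = L 0 (Fin.natAdd _ p.2) :=
      hsupp s (hγs s (left_ne_zero_of_mul hs)) p (right_ne_zero_of_mul hs)
    rw [← hG, ← hH] at h0
    have h1 : G.label p.1 = H.label p.2 := h0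
    rw [h1, dist_self, mul_zero]

/-- Projection of the features of two parallel networks onto the first one. -/
noncomputable def dimSeqFst (d : ℕ) (t t' : ℕ → ℕ) : (i : ℕ) →
    EuclideanSpace ℝ (Fin (dimSeq d (t + t') i)) →ₗ[ℝ] EuclideanSpace ℝ (Fin (dimSeq d t i))
  | 0 => LinearMap.id
  | i + 1 =>
    { toFun := fun x : EuclideanSpace ℝ (Fin (t i + t' i)) =>
        (WithLp.toLp 2 fun j => x (Fin.castAdd (t' i) j) : EuclideanSpace ℝ (Fin (t i)))
      map_add' := fun _ _ => rfl
      map_smul' := fun _ _ => rfl }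

/-- Projection of the features of two parallel networks onto the second one. -/
noncomputable def dimSeqSnd (d : ℕ) (t t' : ℕ → ℕ) : (i : ℕ) →
    EuclideanSpace ℝ (Fin (dimSeq d (t + t') i)) →ₗ[ℝ] EuclideanSpace ℝ (Fin (dimSeq d t' i))
  | 0 => LinearMap.id
  | i + 1 =>
    { toFun := fun x : EuclideanSpace ℝ (Fin (t i + t' i)) =>
        (WithLp.toLp 2 fun j => x (Fin.natAdd (t i) j) : EuclideanSpace ℝ (Fin (t' i)))
      map_add' := fun _ _ => rfl
      map_smul' := fun _ _ => rfl }

theorem exists_lipschitzWith_linearMap {m n : ℕ}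
    (f : EuclideanSpace ℝ (Fin m) →ₗ[ℝ] EuclideanSpace ℝ (Fin n)) :
    ∃ c : NNReal, LipschitzWith c f :=
  ⟨_, f.toContinuousLinearMap.lipschitz⟩

theorem map_sum_smul_of_eq {ι E F : Type*} [Fintype ι] [AddCommGroup E] [Module ℝ E]
    [AddCommGroup F] [Module ℝ F] (T : E →ₗ[ℝ] F) {p : ι → ℝ} {u : ι → E} {u' : ι → F}
    (h : ∀ i, T (u i) = u' i) : T (∑ i, p i • u i) = ∑ i, p i • u' i := by
  simp only [map_sum, map_smul, h]

/-- Two MP-GNNs can be run in parallel by a single one. -/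
theorem exists_parallel {d : ℕ} (q : ℝ) (k : ℕ) (t t' : ℕ → ℕ)
    (φ : (i : ℕ) → EuclideanSpace ℝ (Fin (dimSeq d t i)) →
      EuclideanSpace ℝ (Fin (dimSeq d t (i + 1))))
    (φ' : (i : ℕ) → EuclideanSpace ℝ (Fin (dimSeq d t' i)) →
      EuclideanSpace ℝ (Fin (dimSeq d t' (i + 1))))
    (hφ : ∀ i, ∃ c : NNReal, LipschitzWith c (φ i))
    (hφ' : ∀ i, ∃ c : NNReal, LipschitzWith c (φ' i)) :
    ∃ Φ : (i : ℕ) → EuclideanSpace ℝ (Fin (dimSeq d (t + t') i)) →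
        EuclideanSpace ℝ (Fin (dimSeq d (t + t') (i + 1))),
      (∀ i, ∃ c : NNReal, LipschitzWith c (Φ i)) ∧ ∀ G : LabeledGraph d,
        dimSeqFst d t t' (k + 1) (gnnFeature q (dimSeq d (t + t')) k Φ G) =
          gnnFeature q (dimSeq d t) k φ G ∧
        dimSeqSnd d t t' (k + 1) (gnnFeature q (dimSeq d (t + t')) k Φ G) =
          gnnFeature q (dimSeq d t') k φ' G := by
  let Φ : (i : ℕ) → EuclideanSpace ℝ (Fin (dimSeq d (t + t') i)) →
      EuclideanSpace ℝ (Fin (dimSeq d (t + t') (i + 1))) := fun i x =>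
    (WithLp.toLp 2 fun j : Fin (t i + t' i) =>
      Fin.append (φ i (dimSeqFst d t t' i x)) (φ' i (dimSeqSnd d t t' i x)) j :
      EuclideanSpace ℝ (Fin (t i + t' i)))
  have hfst : ∀ i x, dimSeqFst d t t' (i + 1) (Φ i x) = φ i (dimSeqFst d t t' i x) := by
    intro i x
    refine PiLp.ext fun j => ?_
    exact Fin.append_left _ _ j
  have hsnd : ∀ i x, dimSeqSnd d t t' (i + 1) (Φ i x) = φ' i (dimSeqSnd d t t' i x) := by
    intro i x
    refine PiLp.ext fun j => ?_
    exact Fin.append_right _ _ j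
  have hcoord : ∀ (n : ℕ) (j : Fin n),
      LipschitzWith 1 fun x : EuclideanSpace ℝ (Fin n) => x j := fun n j =>
    .mk_one fun x y => by
      rw [Real.dist_eq, dist_eq_norm, ← Real.norm_eq_abs]
      exact PiLp.norm_apply_le (x - y) j
  refine ⟨Φ, fun i => ?_, fun G => ?_⟩
  · refine exists_lipschitzWith_toLp _ fun j : Fin (t i + t' i) => ?_
    obtain ⟨c, hc⟩ := hφ i
    obtain ⟨c', hc'⟩ := hφ' i
    obtain ⟨e, he⟩ := exists_lipschitzWith_linearMap (dimSeqFst d t t' i)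
    obtain ⟨e', he'⟩ := exists_lipschitzWith_linearMap (dimSeqSnd d t t' i)
    induction j using Fin.addCases with
    | left j =>
      refine ⟨_, Eq.mp (congrArg _ (funext fun x => ?_)) ((hcoord (t i) j).comp (hc.comp he))⟩
      exact (Fin.append_left _ _ j).symm
    | right j =>
      refine ⟨_, Eq.mp (congrArg _ (funext fun x => ?_)) ((hcoord (t' i) j).comp (hc'.comp he'))⟩
      exact (Fin.append_right _ _ j).symm
  · have hF : ∀ i v, dimSeqFst d t t' i (gnnLabel q (dimSeq d (t + t')) Φ G i v) =
        gnnLabel q (dimSeq d t) φ G i v := by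
      intro i
      induction i with
      | zero => exact fun v => rfl
      | succ i ih =>
        exact fun v => (congrArg _ (gnnLabel_succ q (dimSeq d (t + t')) Φ G i v)).trans
          ((map_sum_smul_of_eq _ fun v' => (hfst i _).trans (congrArg (φ i) (ih v'))).trans
            (gnnLabel_succ q (dimSeq d t) φ G i v).symm)
    have hS : ∀ i v, dimSeqSnd d t t' i (gnnLabel q (dimSeq d (t + t')) Φ G i v) =
        gnnLabel q (dimSeq d t') φ' G i v := by
      intro i
      induction i with
      | zero => exact fun v => rfl
      | succ i ih =>
        exact fun v => (congrArg _ (gnnLabel_succ q (dimSeq d (t + t')) Φ G i v)).trans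
          ((map_sum_smul_of_eq _ fun v' => (hsnd i _).trans (congrArg (φ' i) (ih v'))).trans
            (gnnLabel_succ q (dimSeq d t') φ' G i v).symm)
    exact ⟨map_sum_smul_of_eq _ fun v => (hfst k _).trans (congrArg (φ k) (hF k v)),
      map_sum_smul_of_eq _ fun v => (hsnd k _).trans (congrArg (φ' k) (hS k v))⟩

/-- The functions realized by `k`-layer MP-GNNs with damping `q`. -/
def mpgnnClass (q : ℝ) (d k : ℕ) : Set (LabeledGraph d → ℝ) :=
  {g | ∃ (t : ℕ → ℕ) (φ : (i : ℕ) → EuclideanSpace ℝ (Fin (dimSeq d t i)) →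
        EuclideanSpace ℝ (Fin (dimSeq d t (i + 1))))
      (ψ : EuclideanSpace ℝ (Fin (dimSeq d t (k + 1))) → ℝ),
      (∀ i, ∃ c : NNReal, LipschitzWith c (φ i)) ∧ (∃ c : NNReal, LipschitzWith c ψ) ∧
      ∀ G, g G = gnnOut q (dimSeq d t) k φ ψ G}

theorem mpgnnClass_comp₂ {q : ℝ} {d k : ℕ} {op : ℝ → ℝ → ℝ}
    (hop : LipschitzWith 1 fun p : ℝ × ℝ => op p.1 p.2) {g h : LabeledGraph d → ℝ}
    (hg : g ∈ mpgnnClass q d k) (hh : h ∈ mpgnnClass q d k) :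
    (fun G => op (g G) (h G)) ∈ mpgnnClass q d k := by
  obtain ⟨t, φ, ψ, hφ, ⟨c, hc⟩, hg⟩ := hg
  obtain ⟨t', φ', ψ', hφ', ⟨c', hc'⟩, hh⟩ := hh
  obtain ⟨Φ, hΦ, hpar⟩ := exists_parallel q k t t' φ φ' hφ hφ'
  obtain ⟨e, he⟩ := exists_lipschitzWith_linearMap (dimSeqFst d t t' (k + 1))
  obtain ⟨e', he'⟩ := exists_lipschitzWith_linearMap (dimSeqSnd d t t' (k + 1))
  refine ⟨t + t', Φ, fun x => op (ψ (dimSeqFst d t t' (k + 1) x)) (ψ' (dimSeqSnd d t t' (k + 1) x)),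
    hΦ, ⟨_, hop.comp ((hc.comp he).prodMk (hc'.comp he'))⟩, fun G => ?_⟩
  exact congrArg₂ op ((hg G).trans (congrArg ψ (hpar G).1.symm))
    ((hh G).trans (congrArg ψ' (hpar G).2.symm))

theorem mpgnn_universal_approximation (q : ℝ) (hq0 : 0 < q) (hq1 : q < 1)
    (d : ℕ) (hd : 1 ≤ d) (k : ℕ) (K : Set (LabeledGraph d))
    (hK : SeqCompactIn (dGq q k) K) :
    ∀ f : LabeledGraph d → ℝ, ContinuousOnPD (dGq q k) K f →
      ∀ ε > 0, ∃ (t : ℕ → ℕ)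
        (φ : (i : ℕ) → EuclideanSpace ℝ (Fin (dimSeq d t i)) →
          EuclideanSpace ℝ (Fin (dimSeq d t (i + 1))))
        (ψ : EuclideanSpace ℝ (Fin (dimSeq d t (k + 1))) → ℝ),
        (∀ i, ∃ c : NNReal, LipschitzWith c (φ i)) ∧ (∃ c : NNReal, LipschitzWith c ψ) ∧
        ∀ G ∈ K, |f G - gnnOut q (dimSeq d t) k φ ψ G| < ε := by
  intro f hf ε hε
  suffices h : ∃ g ∈ mpgnnClass q d k, ∀ G ∈ K, |f G - g G| < ε by
    obtain ⟨g, ⟨t, φ, ψ, hφ, hψ, hg⟩, h⟩ := h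
    exact ⟨t, φ, ψ, hφ, hψ, fun G hG => hg G ▸ h G hG⟩
  refine exists_approx_of_seqCompact (dGq q k) (dGq_nonneg q k)
    (dGq_comm hq0.le hq1.le k) K hK (mpgnnClass q d k) ?_ ?_
    (fun g hg h hh => mpgnnClass_comp₂ lipschitzWith_min hg hh)
    (fun g hg h hh => mpgnnClass_comp₂ lipschitzWith_max hg hh) ?_ f hf ε hε
  · rintro g ⟨t, φ, ψ, hφ, ⟨c, hc⟩, hg⟩
    obtain ⟨C, -, hC⟩ := exists_dist_gnnFeature_le hq0.le hq1.le (dimSeq d t) k φ hφ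
    refine ⟨c * C, fun G H => ?_⟩
    rw [hg, hg, mul_assoc]
    exact (hc.dist_le_mul _ _).trans (mul_le_mul_of_nonneg_left (hC G H) c.2)
  · exact fun c => ⟨fun _ => 0, fun _ _ => 0, fun _ => c, fun _ => ⟨0, .const _⟩, ⟨0, .const _⟩,
      fun _ => rfl⟩
  · intro G H hGH a b
    obtain ⟨t, φ, hφ, hne⟩ := exists_gnnFeature_ne hq0.le hq1.le k G H hGH
    set x := gnnFeature q (dimSeq d t) k φ G
    set y := gnnFeature q (dimSeq d t) k φ H
    let ψ : EuclideanSpace ℝ (Fin (dimSeq d t (k + 1))) → ℝ := fun z =>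
      a + (b - a) / dist y x * dist z x
    refine ⟨_, ⟨t, φ, ψ, hφ, ⟨_, LipschitzWith.of_dist_le' (K := |(b - a) / dist y x|)
      fun z z' => ?_⟩, fun _ => rfl⟩, ?_, ?_⟩
    · rw [Real.dist_eq, add_sub_add_left_eq_sub, ← mul_sub, abs_mul]
      exact mul_le_mul_of_nonneg_left (abs_dist_sub_le z z' x) (abs_nonneg _)
    · change a + (b - a) / dist y x * dist x x = a
      simp
    · change a + (b - a) / dist y x * dist y x = b
      rw [div_mul_cancel₀ _ (dist_ne_zero.2 hne.symm)]
      ring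
end

section
/- For every countable collection C of Borel probability measures on ℝ^d with finite first moment, there exists a Lipschitz function φ : ℝ^d → ℝ such that the map q_φ : α ↦ ∫_{ℝ^d} φ(x) α(dx) is injective when restricted to C. -/
/-!
STATEMENT 16: For every countable collection `C` of Borel probability measures on ℝ^d with
finite first moment, there exists a Lipschitz function `φ : ℝ^d → ℝ` such that
`q_φ : α ↦ ∫ φ dα` is injective on `C`.
-/

open MeasureTheory

/-- A power series with bounded coefficients, not all zero, is nonzero at almost every point of
the open unit ball. -/
theorem ae_tsum_mul_pow_ne_zero_of_bounded {c : ℕ → ℝ} {B : ℝ} (hB : ∀ n, |c n| ≤ B)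
    (hc : c ≠ 0) :
    ∀ᵐ t ∂(volume.restrict (Metric.ball (0 : ℝ) 1)), ∑' n, c n * t ^ n ≠ 0 := by
  let p := FormalMultilinearSeries.ofScalars ℝ c
  have hrad : ((1 : NNReal) : ENNReal) ≤ p.radius :=
    p.le_radius_of_bound B fun n => by
      simpa [p, FormalMultilinearSeries.ofScalars_norm] using hB n
  have hp : HasFPowerSeriesOnBall p.sum p 0 p.radius :=
    p.hasFPowerSeriesOnBall (lt_of_lt_of_le (by simp) hrad)
  have hsum : p.sum = fun t : ℝ => ∑' n, c n * t ^ n :=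
    FormalMultilinearSeries.ofScalarsSum_eq_tsum (E := ℝ) c
  have han : AnalyticOnNhd ℝ p.sum (Metric.ball 0 1) := by
    refine hp.analyticOnNhd.mono ?_
    rw [← Metric.eball_ofReal]
    exact Metric.eball_subset_eball (by simpa using hrad)
  rcases han.eqOn_zero_or_eventually_ne_zero_of_preconnected
    (convex_ball (0 : ℝ) 1).isPreconnected with hzero | hne
  · have hp0 : p = 0 := hp.hasFPowerSeriesAt.eq_zero_of_eventually
      (hzero.eventuallyEq_of_mem (Metric.ball_mem_nhds 0 one_pos))
    exact absurd ((FormalMultilinearSeries.ofScalars_series_eq_zero ℝ).1 hp0) hc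
  · rw [hsum] at hne
    exact ae_restrict_le_codiscreteWithin Metric.isOpen_ball.measurableSet hne

/-- A geometric series of `1`-Lipschitz functions with values in `[-1, 1]` is Lipschitz. -/
theorem exists_lipschitzWith_tsum_mul_pow {Ω : Type*} [PseudoMetricSpace Ω] {ψ : ℕ → Ω → ℝ}
    (hlip : ∀ n, LipschitzWith 1 (ψ n)) (hbd : ∀ n x, |ψ n x| ≤ 1) {t : ℝ} (ht : |t| < 1) :
    ∃ K : NNReal, LipschitzWith K fun x => ∑' n, ψ n x * t ^ n := by
  have hgeom : Summable fun n : ℕ => |t| ^ n := summable_geometric_of_lt_one (abs_nonneg t) ht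
  have hsum (x : Ω) : Summable fun n => ψ n x * t ^ n :=
    hgeom.of_norm_bounded fun n => by
      rw [Real.norm_eq_abs, abs_mul, abs_pow]
      exact mul_le_of_le_one_left (by positivity) (hbd n x)
  refine ⟨(∑' n : ℕ, |t| ^ n).toNNReal, LipschitzWith.of_dist_le_mul fun x y => ?_⟩
  rw [Real.coe_toNNReal _ (tsum_nonneg fun n => by positivity), dist_eq_norm,
    ← (hsum x).tsum_sub (hsum y), ← tsum_mul_right]
  refine tsum_of_norm_bounded (hgeom.mul_right _).hasSum fun n => ?_
  rw [← sub_mul, Real.norm_eq_abs, abs_mul, abs_pow, mul_comm]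
  gcongr
  simpa [Real.dist_eq] using (hlip n).dist_le_mul x y

section Metric

variable {Ω : Type*} [PseudoMetricSpace Ω] [MeasurableSpace Ω] [BorelSpace Ω]

/-- Distinct finite Borel measures are separated by a `1`-Lipschitz function with values in the
unit interval. -/
theorem exists_lipschitzWith_one_integral_ne {μ ν : Measure Ω} [IsFiniteMeasure μ]
    [IsFiniteMeasure ν] (hne : μ ≠ ν) :
    ∃ ψ : Ω → ℝ, LipschitzWith 1 ψ ∧ (∀ x, |ψ x| ≤ 1) ∧ ∫ x, ψ x ∂μ ≠ ∫ x, ψ x ∂ν := by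
  by_contra! H
  have hthick (F : Set Ω) {δ : ℝ} (hδ : 0 < δ) (hδ1 : δ ≤ 1) :
      ∫⁻ x, thickenedIndicator hδ F x ∂μ = ∫⁻ x, thickenedIndicator hδ F x ∂ν := by
    have hlip : LipschitzWith 1 fun x => δ * (thickenedIndicator hδ F x : ℝ) := by
      refine LipschitzWith.of_dist_le_mul fun x y => ?_
      have h := (lipschitzWith_thickenedIndicator hδ F).dist_le_mul x y
      rw [NNReal.coe_inv, Real.coe_toNNReal _ hδ.le] at h
      rw [Real.dist_eq, ← mul_sub, abs_mul, abs_of_pos hδ, ← NNReal.dist_eq, NNReal.coe_one,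
        one_mul]
      calc δ * dist (thickenedIndicator hδ F x) (thickenedIndicator hδ F y)
          ≤ δ * (δ⁻¹ * dist x y) := by gcongr
        _ = dist x y := by field_simp
    have hbd (x : Ω) : |δ * (thickenedIndicator hδ F x : ℝ)| ≤ 1 := by
      rw [abs_of_nonneg (by positivity)]
      exact mul_le_one₀ hδ1 (by positivity) (mod_cast thickenedIndicator_le_one hδ F x)
    have h := H _ hlip hbd
    rw [integral_const_mul, integral_const_mul] at h
    rw [lintegral_coe_eq_integral _ (integrable_thickenedIndicator F hδ),
      lintegral_coe_eq_integral _ (integrable_thickenedIndicator F hδ),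
      mul_left_cancel₀ hδ.ne' h]
  have hclosed (F : Set Ω) (hF : IsClosed F) : μ F = ν F := by
    have hpos (n : ℕ) : (0 : ℝ) < 1 / (n + 1) := Nat.one_div_pos_of_nat
    have hμ := tendsto_lintegral_thickenedIndicator_of_isClosed μ hF hpos
      tendsto_one_div_add_atTop_nhds_zero_nat
    have hν := tendsto_lintegral_thickenedIndicator_of_isClosed ν hF hpos
      tendsto_one_div_add_atTop_nhds_zero_nat
    refine tendsto_nhds_unique hμ (hν.congr fun n => (hthick F (hpos n) ?_).symm)
    rw [div_le_one (by positivity)]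
    linarith [(n.cast_nonneg : (0 : ℝ) ≤ n)]
  refine hne (ext_of_generate_finite _ ?_ isPiSystem_isClosed hclosed (hclosed _ isClosed_univ))
  rw [BorelSpace.measurable_eq (α := Ω), borel_eq_generateFrom_isClosed]

/-- Integration term by term of a geometric series of continuous functions with values in
`[-1, 1]`. -/
theorem integral_tsum_mul_pow {ψ : ℕ → Ω → ℝ} (hcont : ∀ n, Continuous (ψ n))
    (hbd : ∀ n x, |ψ n x| ≤ 1) {t : ℝ} (ht : |t| < 1) (μ : Measure Ω) [IsFiniteMeasure μ] :
    HasSum (fun n => (∫ x, ψ n x ∂μ) * t ^ n) (∫ x, ∑' n, ψ n x * t ^ n ∂μ) := by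
  have hgeom : Summable fun n : ℕ => |t| ^ n := summable_geometric_of_lt_one (abs_nonneg t) ht
  have hle (n : ℕ) (x : Ω) : ‖ψ n x * t ^ n‖ ≤ |t| ^ n := by
    rw [Real.norm_eq_abs, abs_mul, abs_pow]
    exact mul_le_of_le_one_left (by positivity) (hbd n x)
  have h := hasSum_integral_of_dominated_convergence (μ := μ)
    (F := fun n x => ψ n x * t ^ n) (f := fun x => ∑' n, ψ n x * t ^ n) (fun n _ => |t| ^ n)
    (fun n => ((hcont n).mul continuous_const).measurable.aestronglyMeasurable)
    (fun n => .of_forall (hle n)) (.of_forall fun _ => hgeom) (integrable_const _)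
    (.of_forall fun x => (hgeom.of_norm_bounded fun n => hle n x).hasSum)
  simpa only [integral_mul_const] using h

/-- Countably many probability measures on a metric space are separated by the integral of a
single Lipschitz function. -/
theorem exists_lipschitzWith_injOn_integral {C : Set (Measure Ω)} (hC : C.Countable)
    (hprob : ∀ μ ∈ C, IsProbabilityMeasure μ) :
    ∃ (K : NNReal) (φ : Ω → ℝ), LipschitzWith K φ ∧
      Set.InjOn (fun μ : Measure Ω => ∫ x, φ x ∂μ) C := by
  rcases C.offDiag.eq_empty_or_nonempty with hempty | hnonempty
  · exact ⟨0, fun _ => 0, LipschitzWith.const 0,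
      (Set.offDiag_eq_empty.1 hempty).injOn _⟩
  have hcount : C.offDiag.Countable := (hC.prod hC).mono C.offDiag_subset_prod
  obtain ⟨g, hg⟩ := hcount.exists_eq_range hnonempty
  have hmem (n : ℕ) : g n ∈ C.offDiag := hg ▸ Set.mem_range_self n
  have (n : ℕ) : IsProbabilityMeasure (g n).1 := hprob _ (hmem n).1
  have (n : ℕ) : IsProbabilityMeasure (g n).2 := hprob _ (hmem n).2.1
  choose ψ hlip hbd hsep using fun n => exists_lipschitzWith_one_integral_ne (hmem n).2.2
  have habs (n : ℕ) (μ : Measure Ω) [IsProbabilityMeasure μ] : |∫ x, ψ n x ∂μ| ≤ 1 := by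
    simpa using norm_integral_le_of_norm_le_const (μ := μ) (f := ψ n) (C := 1)
      (.of_forall (hbd n))
  have hae : ∀ᵐ t ∂(volume.restrict (Metric.ball (0 : ℝ) 1)), ∀ m,
      ∑' n, (∫ x, ψ n x ∂(g m).1 - ∫ x, ψ n x ∂(g m).2) * t ^ n ≠ 0 := by
    refine ae_all_iff.2 fun m => ae_tsum_mul_pow_ne_zero_of_bounded (B := 2) (fun n => ?_)
      fun h => hsep m (sub_eq_zero.1 (congrFun h m))
    linarith [abs_sub (∫ x, ψ n x ∂(g m).1) (∫ x, ψ n x ∂(g m).2), habs n (g m).1,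
      habs n (g m).2]
  have hball : (volume.restrict (Metric.ball (0 : ℝ) 1)) ≠ 0 := by
    simp [Measure.restrict_eq_zero]
  have : NeZero (volume.restrict (Metric.ball (0 : ℝ) 1)) := ⟨hball⟩
  obtain ⟨t, hne, ht⟩ := (hae.and (ae_restrict_mem Metric.isOpen_ball.measurableSet)).exists
  replace ht : |t| < 1 := by simpa using ht
  obtain ⟨K, hK⟩ := exists_lipschitzWith_tsum_mul_pow hlip hbd ht
  refine ⟨K, _, hK, fun μ hμ ν hν heq => ?_⟩
  by_contra hμν
  obtain ⟨m, hm⟩ : (μ, ν) ∈ Set.range g := hg ▸ ⟨hμ, hν, hμν⟩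
  apply hne m
  have hcont (n : ℕ) := (hlip n).continuous
  have h := (integral_tsum_mul_pow hcont hbd ht (g m).1).sub
    (integral_tsum_mul_pow hcont hbd ht (g m).2)
  simp only [← sub_mul] at h
  rw [h.tsum_eq, hm]
  exact sub_eq_zero.2 heq

end Metric

theorem countable_family_admits_injective_lipschitz_moment (d : ℕ)
    (C : Set (Measure (EuclideanSpace ℝ (Fin d))))
    (hC : C.Countable)
    (hprob : ∀ μ ∈ C, IsProbabilityMeasure μ)
    (hmom : ∀ μ ∈ C, Integrable (fun x => ‖x‖) μ) :
    ∃ (K : NNReal) (φ : EuclideanSpace ℝ (Fin d) → ℝ), LipschitzWith K φ ∧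
      Set.InjOn (fun μ : Measure (EuclideanSpace ℝ (Fin d)) => ∫ x, φ x ∂μ) C :=
  exists_lipschitzWith_injOn_integral hC hprob
end
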